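/- arXiv:math/9201258 — 8 statements merged into one kernel-verified Lean document; each statement's English description precedes it below -/
import Mathlib

section
/- Fix an integer n ≥ 1 and a real number α > 0. On the space E of all n×n real matrices, consider the symmetric bilinear form γ^α(H,K) = tr(H₀K₀) + α·tr(H)·tr(K), where H₀ = H − (tr(H)/n)·I is the traceless part. Then there exist subspaces P and N of E with E = P ⊕ N, γ^α(x,y) = 0 for all x ∈ P, y ∈ N, γ^α positive definite on P and negative definite on N, and dim N = n(n−1)/2. -/
open Matrix

/-- The bilinear form `γ^α(H,K) = tr(H₀K₀) + α·tr(H)·tr(K)` on `n×n` matrices,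
where `H₀ = H − (tr(H)/n)·I` is the traceless part. -/
noncomputable def gammaAlpha (n : ℕ) (α : ℝ)
    (H K : Matrix (Fin n) (Fin n) ℝ) : ℝ :=
  ((H - (H.trace / (n : ℝ)) • (1 : Matrix (Fin n) (Fin n) ℝ)) *
      (K - (K.trace / (n : ℝ)) • (1 : Matrix (Fin n) (Fin n) ℝ))).trace +
    α * H.trace * K.trace

theorem aux_nonneg {n : ℕ} (A : Matrix (Fin n) (Fin n) ℝ) : 0 ≤ (Aᵀ * A).trace := by
  simp only [Matrix.trace, Matrix.diag, Matrix.mul_apply, Matrix.transpose_apply]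
  exact Finset.sum_nonneg fun i _ => Finset.sum_nonneg fun j _ => mul_self_nonneg _

theorem aux_pos {n : ℕ} (A : Matrix (Fin n) (Fin n) ℝ) (hA : A ≠ 0) : 0 < (Aᵀ * A).trace := by
  refine lt_of_le_of_ne (aux_nonneg A) fun h => hA ?_
  simp only [Matrix.trace, Matrix.diag, Matrix.mul_apply, Matrix.transpose_apply] at h
  ext i j
  have h1 := (Finset.sum_eq_zero_iff_of_nonneg (fun i _ => Finset.sum_nonneg
    fun j _ => mul_self_nonneg (A j i))).1 h.symm j (Finset.mem_univ _)
  have h2 := (Finset.sum_eq_zero_iff_of_nonneg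
    (fun i _ => mul_self_nonneg (A i j))).1 h1 i (Finset.mem_univ _)
  simpa using h2

def skewSub (n : ℕ) : Submodule ℝ (Matrix (Fin n) (Fin n) ℝ) where
  carrier := {A | Aᵀ = -A}
  add_mem' := by
    intro a b ha hb
    simp only [Set.mem_ofPred_eq] at *
    rw [Matrix.transpose_add, ha, hb]; abel
  zero_mem' := by simp
  smul_mem' := by
    intro c a ha
    simp only [Set.mem_ofPred_eq] at *
    rw [Matrix.transpose_smul, ha, smul_neg]

def symSub (n : ℕ) : Submodule ℝ (Matrix (Fin n) (Fin n) ℝ) where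
  carrier := {A | Aᵀ = A}
  add_mem' := by
    intro a b ha hb
    simp only [Set.mem_ofPred_eq] at *
    rw [Matrix.transpose_add, ha, hb]
  zero_mem' := by simp
  smul_mem' := by
    intro c a ha
    simp only [Set.mem_ofPred_eq] at *
    rw [Matrix.transpose_smul, ha]

theorem mem_skewSub {n : ℕ} {A : Matrix (Fin n) (Fin n) ℝ} : A ∈ skewSub n ↔ Aᵀ = -A := Iff.rfl

theorem mem_symSub {n : ℕ} {A : Matrix (Fin n) (Fin n) ℝ} : A ∈ symSub n ↔ Aᵀ = A := Iff.rfl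

def skewFun (n : ℕ) : skewSub n →ₗ[ℝ] ((Σ j : Fin n, Fin j.val) → ℝ) where
  toFun A := fun p => A.1 ⟨p.2.1, p.2.2.trans p.1.2⟩ p.1
  map_add' _ _ := rfl
  map_smul' _ _ := rfl

theorem skew_entry {n : ℕ} {A : Matrix (Fin n) (Fin n) ℝ} (h : A ∈ skewSub n) (i j : Fin n) :
    A j i = - A i j := by
  have := congrFun (congrFun (mem_skewSub.1 h) i) j
  simpa using this

theorem skewFun_bij (n : ℕ) : Function.Bijective (skewFun n) := by
  constructor
  · rw [injective_iff_map_eq_zero]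
    rintro ⟨A, hA⟩ h
    have key : ∀ i j : Fin n, i < j → A i j = 0 := fun i j hij =>
      congrFun h ⟨j, ⟨i.1, hij⟩⟩
    ext i j
    change A i j = 0
    rcases lt_trichotomy i j with h1 | h1 | h1
    · exact key i j h1
    · subst h1
      have := skew_entry hA i i
      linarith
    · rw [skew_entry hA j i, key j i h1, neg_zero]
  · intro f
    refine ⟨⟨Matrix.of fun i j => if h : i.1 < j.1 then f ⟨j, ⟨i.1, h⟩⟩ else
      if h : j.1 < i.1 then - f ⟨i, ⟨j.1, h⟩⟩ else 0, ?_⟩, ?_⟩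
    · rw [mem_skewSub]
      ext i j
      simp only [Matrix.transpose_apply, Matrix.neg_apply, Matrix.of_apply]
      rcases lt_trichotomy i.1 j.1 with h1 | h1 | h1
      · simp [h1, h1.not_gt]
      · simp [h1]
      · simp [h1, h1.not_gt]
    · funext p
      obtain ⟨j, i, hi⟩ := p
      exact dif_pos hi

theorem skew_finrank (n : ℕ) : Module.finrank ℝ (skewSub n) = n * (n - 1) / 2 := by
  rw [(LinearEquiv.ofBijective (skewFun n) (skewFun_bij n)).finrank_eq,
    Module.finrank_fintype_fun_eq_card, Fintype.card_sigma]
  simp only [Fintype.card_fin]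
  rw [Fin.sum_univ_eq_sum_range (fun i => i) n, Finset.sum_range_id]

theorem skew_trace {n : ℕ} {A : Matrix (Fin n) (Fin n) ℝ} (h : A ∈ skewSub n) :
    A.trace = 0 := by
  have := congrArg Matrix.trace (mem_skewSub.1 h)
  rw [Matrix.trace_transpose, Matrix.trace_neg] at this
  linarith

theorem stmt2 (n : ℕ) (hn : 1 ≤ n) (α : ℝ) (hα : 0 < α) :
    ∃ P N : Submodule ℝ (Matrix (Fin n) (Fin n) ℝ),
      IsCompl P N ∧
      (∀ x ∈ P, ∀ y ∈ N, gammaAlpha n α x y = 0) ∧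
      (∀ x ∈ P, x ≠ 0 → 0 < gammaAlpha n α x x) ∧
      (∀ x ∈ N, x ≠ 0 → gammaAlpha n α x x < 0) ∧
      Module.finrank ℝ N = n * (n - 1) / 2 := by
  refine ⟨symSub n, skewSub n, ?_, ?_, ?_, ?_, skew_finrank n⟩
  · constructor
    · rw [Submodule.disjoint_def]
      intro x hx hy
      rw [mem_symSub] at hx
      ext i j
      have h1 := skew_entry hy i j
      have h2 : x j i = x i j := congrFun (congrFun hx i) j
      simp only [Matrix.zero_apply]
      linarith
    · rw [codisjoint_iff, eq_top_iff]
      intro x _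
      rw [Submodule.mem_sup]
      refine ⟨(1/2 : ℝ) • (x + xᵀ), ?_, (1/2 : ℝ) • (x - xᵀ), ?_, ?_⟩
      · rw [mem_symSub]
        ext i j
        simp
        ring
      · rw [mem_skewSub]
        ext i j
        simp
        ring
      · ext i j
        simp
        ring
  · intro x hx y hy
    have ht := skew_trace hy
    have h : (x * y).trace = 0 := by
      have h1 : (x * y).trace = ((x * y)ᵀ).trace := (Matrix.trace_transpose _).symm
      rw [Matrix.transpose_mul, mem_symSub.1 hx, mem_skewSub.1 hy, Matrix.neg_mul,
        Matrix.trace_neg, Matrix.trace_mul_comm y x] at h1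
      linarith
    simp [gammaAlpha, ht, Matrix.sub_mul, h]
  · intro x hx hx0
    rw [mem_symSub] at hx
    unfold gammaAlpha
    by_cases ht : x.trace = 0
    · have := aux_pos x hx0
      rw [hx] at this
      simpa [ht] using this
    · have h := aux_nonneg (x - (x.trace / (n : ℝ)) • (1 : Matrix (Fin n) (Fin n) ℝ))
      rw [Matrix.transpose_sub, Matrix.transpose_smul, Matrix.transpose_one, hx] at h
      have : 0 < α * x.trace * x.trace := by
        rw [mul_assoc]
        exact mul_pos hα (mul_self_pos.2 ht)
      linarith
  · intro x hx hx0
    have := aux_pos x hx0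
    rw [mem_skewSub.1 hx, Matrix.neg_mul, Matrix.trace_neg] at this
    simp only [gammaAlpha, skew_trace hx, zero_div, zero_smul, sub_zero, mul_zero, add_zero]
    linarith
end

section
/- Fix an integer n ≥ 1 and a real number α < 0. On the space E of all n×n real matrices, consider the symmetric bilinear form γ^α(H,K) = tr(H₀K₀) + α·tr(H)·tr(K), where H₀ = H − (tr(H)/n)·I is the traceless part. Then there exist subspaces P and N of E with E = P ⊕ N, γ^α(x,y) = 0 for all x ∈ P, y ∈ N, γ^α positive definite on P and negative definite on N, and dim N = n(n−1)/2 + 1. -/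
open Matrix

noncomputable def auxL (n : ℕ) :
    (((Σ i : Fin n, Fin i.val) → ℝ) × ℝ) →ₗ[ℝ] Matrix (Fin n) (Fin n) ℝ where
  toFun p := Matrix.of fun i j =>
    if h : j < i then p.1 ⟨i, ⟨j.1, h⟩⟩ else if h : i < j then - p.1 ⟨j, ⟨i.1, h⟩⟩ else p.2
  map_add' p q := by
    ext i j
    simp only [Matrix.of_apply, Matrix.add_apply, Prod.fst_add, Prod.snd_add, Pi.add_apply]
    split_ifs <;> ring
  map_smul' c q := by
    ext i j
    simp only [Matrix.of_apply, Matrix.smul_apply, Prod.smul_fst, Prod.smul_snd, Pi.smul_apply,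
      smul_eq_mul, RingHom.id_apply]
    split_ifs <;> ring

theorem auxL_apply (n : ℕ) (p) (i j : Fin n) : auxL n p i j =
    if h : j < i then p.1 ⟨i, ⟨j.1, h⟩⟩ else if h : i < j then - p.1 ⟨j, ⟨i.1, h⟩⟩ else p.2 := rfl

theorem auxL_inj (n : ℕ) (hn : 1 ≤ n) : Function.Injective (auxL n) := by
  rintro p q h
  have h' : ∀ i j, auxL n p i j = auxL n q i j := fun i j => by rw [h]
  ext a
  · obtain ⟨i, j, hj⟩ := a
    have := h' i ⟨j, hj.trans i.2⟩
    have hlt : (⟨j, hj.trans i.2⟩ : Fin n) < i := hj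
    simpa [auxL_apply, hlt] using this
  · have := h' ⟨0, hn⟩ ⟨0, hn⟩
    simpa [auxL_apply] using this

theorem mem_auxL (n : ℕ) (x : Matrix (Fin n) (Fin n) ℝ) :
    x ∈ LinearMap.range (auxL n) ↔ ∃ c : ℝ, x + xᵀ = (2 * c) • (1 : Matrix (Fin n) (Fin n) ℝ) := by
  constructor
  · rintro ⟨p, rfl⟩
    refine ⟨p.2, ?_⟩
    ext i j
    rcases lt_trichotomy i j with h | h | h
    · simp [auxL_apply, h, h.not_gt, h.ne]
    · subst h
      simp [auxL_apply]; ring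
    · simp [auxL_apply, h, h.not_gt, h.ne']
  · rintro ⟨c, h⟩
    refine ⟨(fun a => x a.1 ⟨a.2.1, a.2.2.trans a.1.2⟩, c), ?_⟩
    ext i j
    have hij := congrFun (congrFun h i) j
    rcases lt_trichotomy i j with h | h | h
    · simp [h.ne] at hij
      simp [auxL_apply, h, h.not_gt]
      linarith
    · subst h
      simp at hij
      simp [auxL_apply]; linarith
    · simp [auxL_apply, h]

theorem trace_tm_pos {n : ℕ} (x : Matrix (Fin n) (Fin n) ℝ) (hx : x ≠ 0) :
    0 < (xᵀ * x).trace := by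
  have h1 : (xᵀ * x).trace = ∑ i, ∑ j, x j i ^ 2 := by
    simp [Matrix.trace, Matrix.mul_apply, sq]
  have h0 : 0 ≤ (xᵀ * x).trace := by rw [h1]; positivity
  refine lt_of_le_of_ne h0 fun h => hx ?_
  have := Matrix.trace_conjTranspose_mul_self_eq_zero_iff (A := x)
  rw [Matrix.conjTranspose_eq_transpose_of_trivial] at this
  exact this.1 h.symm

theorem stmt3 (n : ℕ) (hn : 1 ≤ n) (α : ℝ) (hα : α < 0) :
    ∃ P N : Submodule ℝ (Matrix (Fin n) (Fin n) ℝ),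
      IsCompl P N ∧
      (∀ x ∈ P, ∀ y ∈ N, gammaAlpha n α x y = 0) ∧
      (∀ x ∈ P, x ≠ 0 → 0 < gammaAlpha n α x x) ∧
      (∀ x ∈ N, x ≠ 0 → gammaAlpha n α x x < 0) ∧
      Module.finrank ℝ N = n * (n - 1) / 2 + 1 := by
  have hn0 : (n : ℝ) ≠ 0 := by positivity
  let P : Submodule ℝ (Matrix (Fin n) (Fin n) ℝ) :=
    { carrier := {x | xᵀ = x ∧ x.trace = 0}
      add_mem' := by
        rintro a b ⟨h1, h2⟩ ⟨h3, h4⟩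
        exact ⟨by rw [transpose_add, h1, h3], by rw [trace_add, h2, h4, add_zero]⟩
      zero_mem' := by simp
      smul_mem' := by
        rintro c a ⟨h1, h2⟩
        exact ⟨by rw [transpose_smul, h1], by rw [trace_smul, h2, smul_zero]⟩ }
  have hP : ∀ x ∈ P, x ≠ 0 → 0 < gammaAlpha n α x x := by
    rintro x ⟨h1, h2⟩ hx
    have := trace_tm_pos x hx
    rw [h1] at this
    simpa [gammaAlpha, h2] using this
  have hN : ∀ x ∈ LinearMap.range (auxL n), x ≠ 0 → gammaAlpha n α x x < 0 := by
    intro x hx hx0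
    obtain ⟨c, h⟩ := (mem_auxL n x).1 hx
    have ht : x.trace = n * c := by
      have := congrArg trace h
      simp at this
      linarith
    have hc : x.trace / n = c := by rw [ht]; field_simp
    unfold gammaAlpha
    rw [hc]
    have hxt : xᵀ = (2 * c) • (1 : Matrix (Fin n) (Fin n) ℝ) - x := by rw [← h]; abel
    set y := x - c • (1 : Matrix (Fin n) (Fin n) ℝ) with hy
    have hyt : yᵀ = - y := by
      rw [hy, transpose_sub, hxt, transpose_smul, transpose_one, two_mul, add_smul]; abel
    by_cases hy0 : y = 0
    · have hc0 : c ≠ 0 := by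
        rintro rfl
        apply hx0
        simpa [hy] using hy0
      have : 0 < (n * c) ^ 2 := by positivity
      rw [hy0, ht]
      simp only [mul_zero, trace_zero, zero_add]
      nlinarith
    · have := trace_tm_pos y hy0
      rw [hyt, neg_mul, trace_neg] at this
      nlinarith [sq_nonneg x.trace]
  refine ⟨P, LinearMap.range (auxL n), ⟨?_, ?_⟩, ?_, hP, hN, ?_⟩
  · rw [Submodule.disjoint_def]
    intro x h1 h2
    by_contra h
    exact lt_asymm (hP x h1 h) (hN x h2 h)
  · rw [codisjoint_iff, Submodule.eq_top_iff']
    intro x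
    rw [Submodule.mem_sup]
    refine ⟨(1/2 : ℝ) • (x + xᵀ) - (x.trace / n) • 1, ⟨?_, ?_⟩,
      (1/2 : ℝ) • (x - xᵀ) + (x.trace / n) • 1, (mem_auxL n _).2 ⟨x.trace / n, ?_⟩, ?_⟩
    · simp [add_comm]
    · simp; field_simp; ring
    · ext i j
      by_cases hij : i = j
      · subst hij
        simp; ring
      · simp [hij]; ring
    · ext i j
      simp; ring
  · rintro x ⟨h1, h2⟩ y hy
    obtain ⟨c, h⟩ := (mem_auxL n y).1 hy
    have hyt : yᵀ = (2 * c) • (1 : Matrix (Fin n) (Fin n) ℝ) - y := by rw [← h]; abel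
    have h3 : (x * y).trace = - (x * y).trace := by
      conv_lhs => rw [← trace_transpose, transpose_mul, h1, hyt, sub_mul, trace_sub, smul_mul_assoc,
        one_mul, trace_smul, h2, trace_mul_comm]
      simp
    have h4 : (x * y).trace = 0 := by linarith
    simp [gammaAlpha, h2, mul_sub, h4]
  · rw [LinearMap.finrank_range_of_inj (auxL_inj n hn)]
    simp [Module.finrank_prod, Fin.sum_univ_eq_sum_range (fun i => i), Finset.sum_range_id]
end

section
/- Fix an integer n ≥ 1 and a real number α ≠ 0. Let b : I → M_n(ℝ) be a twice differentiable curve defined on an open interval I with b(t) invertible for all t, and set B(t) = b(t)⁻¹·b'(t). Then b satisfies the geodesic equation b'' = b'b⁻¹b' − (1/2)tr(b⁻¹b')·b' + (1/(4αn))·tr(b⁻¹b'·b⁻¹b')·b + ((αn−1)/(4αn²))·tr(b⁻¹b')²·b on I if and only if B satisfies B' = (1/(4αn))·tr(B²)·I − (1/2)·tr(B)·B + ((αn−1)/(4αn²))·tr(B)²·I on I. -/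
open Matrix

attribute [local instance] Matrix.normedAddCommGroup Matrix.normedSpace

theorem aux_gen {R : Type*} [NormedRing R] [NormedAlgebra ℝ R] [CompleteSpace R]
    (b c : ℝ → R) (b₁ c₁ : R) (t : ℝ) (hb : HasDerivAt b b₁ t) (hc : HasDerivAt c c₁ t)
    (hu : IsUnit (b t)) :
    HasDerivAt (fun s => Ring.inverse (b s) * c s)
      (Ring.inverse (b t) * c₁ - Ring.inverse (b t) * b₁ * Ring.inverse (b t) * c t) t := by
  obtain ⟨u, hu⟩ := hu
  have h1 := hasFDerivAt_ringInverse (𝕜 := ℝ) u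
  rw [hu] at h1
  have h2 := (h1.comp_hasDerivAt t hb).mul hc
  refine h2.congr_deriv ?_
  simp [← hu, Function.comp]
  abel

theorem aux_mat (n : ℕ) (b c : ℝ → Matrix (Fin n) (Fin n) ℝ) (b₁ c₁ : Matrix (Fin n) (Fin n) ℝ)
    (t : ℝ) (hb : HasDerivAt b b₁ t) (hc : HasDerivAt c c₁ t) (hu : IsUnit (b t)) :
    HasDerivAt (fun s => (b s)⁻¹ * c s) ((b t)⁻¹ * c₁ - (b t)⁻¹ * b₁ * (b t)⁻¹ * c t) t := by
  simp only [Matrix.nonsing_inv_eq_ringInverse]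
  exact @aux_gen _ Matrix.linftyOpNormedRing Matrix.linftyOpNormedAlgebra
    (inferInstanceAs (CompleteSpace (Fin n → Fin n → ℝ))) b c b₁ c₁ t hb hc hu

theorem stmt5 (n : ℕ) (hn : 1 ≤ n) (α : ℝ) (hα : α ≠ 0)
    (I : Set ℝ) (hI : IsOpen I)
    (b b' b'' : ℝ → Matrix (Fin n) (Fin n) ℝ)
    (hb : ∀ t ∈ I, HasDerivAt b (b' t) t)
    (hb' : ∀ t ∈ I, HasDerivAt b' (b'' t) t)
    (hinv : ∀ t ∈ I, IsUnit (b t)) :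
    (∀ t ∈ I,
        b'' t = b' t * (b t)⁻¹ * b' t
          - (((1 : ℝ) / 2) * ((b t)⁻¹ * b' t).trace) • b' t
          + ((1 / (4 * α * (n : ℝ))) * (((b t)⁻¹ * b' t) * ((b t)⁻¹ * b' t)).trace) • b t
          + (((α * (n : ℝ) - 1) / (4 * α * (n : ℝ) ^ 2)) * ((b t)⁻¹ * b' t).trace ^ 2) • b t)
    ↔
    (∀ t ∈ I, HasDerivAt (fun s => (b s)⁻¹ * b' s)
        (((1 / (4 * α * (n : ℝ))) * (((b t)⁻¹ * b' t) * ((b t)⁻¹ * b' t)).trace) •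
            (1 : Matrix (Fin n) (Fin n) ℝ)
          - (((1 : ℝ) / 2) * ((b t)⁻¹ * b' t).trace) • ((b t)⁻¹ * b' t)
          + (((α * (n : ℝ) - 1) / (4 * α * (n : ℝ) ^ 2)) * ((b t)⁻¹ * b' t).trace ^ 2) •
            (1 : Matrix (Fin n) (Fin n) ℝ)) t) := by
  refine forall₂_congr fun t ht => ?_
  have hD := aux_mat n b b' (b' t) (b'' t) t (hb t ht) (hb' t ht) (hinv t ht)
  have hdet : IsUnit (b t).det := (Matrix.isUnit_iff_isUnit_det _).1 (hinv t ht)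
  have e1 : b t * (b t)⁻¹ = 1 := Matrix.mul_nonsing_inv _ hdet
  have e2 : (b t)⁻¹ * b t = 1 := Matrix.nonsing_inv_mul _ hdet
  generalize (1 / (4 * α * (n : ℝ))) * (((b t)⁻¹ * b' t) * ((b t)⁻¹ * b' t)).trace = x
  generalize ((1 : ℝ) / 2) * ((b t)⁻¹ * b' t).trace = y
  generalize ((α * (n : ℝ) - 1) / (4 * α * (n : ℝ) ^ 2)) * ((b t)⁻¹ * b' t).trace ^ 2 = z
  constructor
  · intro h
    refine hD.congr_deriv ?_
    rw [h]
    simp only [mul_add, mul_sub, Matrix.mul_smul, e2, Matrix.mul_assoc]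
    abel
  · intro h
    have h3 := congrArg (fun M => b t * M) (hD.unique h)
    simp only [mul_add, mul_sub, Matrix.mul_smul, ← Matrix.mul_assoc, e1, Matrix.one_mul,
      Matrix.mul_one] at h3
    rw [sub_eq_iff_eq_add] at h3
    rw [h3]
    abel
end

section
/- Fix an integer n ≥ 1 and a real number α ≠ 0. Let X : I → M_n(ℝ) be differentiable on an open interval I and satisfy X' = −(1/2)tr(X)·X + (1/(4αn))tr(X²)·I + ((αn−1)/(4αn²))tr(X)²·I. Then the traceless part X₀ = X − (tr(X)/n)·I satisfies X₀' = −(1/2)·tr(X)·X₀ on I. -/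
open Matrix

attribute [local instance] Matrix.normedAddCommGroup Matrix.normedSpace

theorem stmt7 (n : ℕ) (hn : 1 ≤ n) (α : ℝ) (hα : α ≠ 0)
    (I : Set ℝ) (hI : IsOpen I)
    (X : ℝ → Matrix (Fin n) (Fin n) ℝ)
    (hX : ∀ t ∈ I, HasDerivAt X
        ((-((1 : ℝ) / 2) * (X t).trace) • X t
          + ((1 / (4 * α * (n : ℝ))) * (X t * X t).trace) • (1 : Matrix (Fin n) (Fin n) ℝ)
          + (((α * (n : ℝ) - 1) / (4 * α * (n : ℝ) ^ 2)) * (X t).trace ^ 2) •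
            (1 : Matrix (Fin n) (Fin n) ℝ)) t) :
    ∀ t ∈ I, HasDerivAt
      (fun s => X s - ((X s).trace / (n : ℝ)) • (1 : Matrix (Fin n) (Fin n) ℝ))
      ((-((1 : ℝ) / 2) * (X t).trace) •
        (X t - ((X t).trace / (n : ℝ)) • (1 : Matrix (Fin n) (Fin n) ℝ))) t := by
  intro t ht
  have hn' : (n : ℝ) ≠ 0 := by
    have : n ≠ 0 := by omega
    exact_mod_cast this
  have key : ∀ D : Matrix (Fin n) (Fin n) ℝ, HasDerivAt X D t → HasDerivAt
      (fun s => X s - ((X s).trace / (n : ℝ)) • (1 : Matrix (Fin n) (Fin n) ℝ))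
      (D - (D.trace / (n : ℝ)) • (1 : Matrix (Fin n) (Fin n) ℝ)) t := by
    intro D h
    have htr : HasDerivAt (fun s => (X s).trace) D.trace t := (LinearMap.toContinuousLinearMap
      (Matrix.traceLinearMap (Fin n) ℝ ℝ)).hasFDerivAt.comp_hasDerivAt t h
    exact h.sub ((htr.div_const (n : ℝ)).smul_const (1 : Matrix (Fin n) (Fin n) ℝ))
  refine HasDerivAt.congr_deriv (key _ (hX t ht)) ?_
  simp only [Matrix.trace_add,
    Matrix.trace_smul, Matrix.trace_one, Fintype.card_fin, smul_eq_mul]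
  generalize (X t * X t).trace = b
  generalize (X t).trace = a
  ext i j
  simp only [Matrix.sub_apply, Matrix.add_apply, Matrix.smul_apply, smul_eq_mul]
  generalize (1 : Matrix (Fin n) (Fin n) ℝ) i j = d
  field_simp
  ring
end

section
/- Fix an integer n ≥ 1 and a real number α ≠ 0, and real numbers τ, τ₀. Let p(t) = 1 + (τ/2)t + (t²/16)(τ² + α⁻¹τ₀), and let T > 0 be such that p(t) > 0 for all t ∈ [0,T). Define a(t) = (2/n)·log p(t) and b(t) = ∫₀ᵗ p(s)⁻¹ ds for t ∈ [0,T). Then a and b satisfy a(0) = b(0) = 0, a'(0) = τ/n, b'(0) = 1, and the system a'' = −(n/4)(a')² + (τ₀/(4αn))(b')², b'' = −(n/2)·a'·b' on [0,T). -/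
open Matrix

theorem stmt9 (n : ℕ) (hn : 1 ≤ n) (α : ℝ) (hα : α ≠ 0) (τ τ₀ : ℝ)
    (p : ℝ → ℝ)
    (hp : ∀ t, p t = 1 + (τ / 2) * t + (t ^ 2 / 16) * (τ ^ 2 + α⁻¹ * τ₀))
    (T : ℝ) (hT : 0 < T) (hpos : ∀ t ∈ Set.Ico (0 : ℝ) T, 0 < p t)
    (a b : ℝ → ℝ)
    (ha : ∀ t, a t = (2 / (n : ℝ)) * Real.log (p t))
    (hb : ∀ t, b t = ∫ s in (0 : ℝ)..t, (p s)⁻¹) :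
    a 0 = 0 ∧ b 0 = 0 ∧
    ∃ a' b' : ℝ → ℝ,
      a' 0 = τ / (n : ℝ) ∧ b' 0 = 1 ∧
      ∀ t ∈ Set.Ico (0 : ℝ) T,
        HasDerivAt a (a' t) t ∧ HasDerivAt b (b' t) t ∧
        HasDerivAt a' (-((n : ℝ) / 4) * (a' t) ^ 2 + (τ₀ / (4 * α * (n : ℝ))) * (b' t) ^ 2) t ∧
        HasDerivAt b' (-((n : ℝ) / 2) * a' t * b' t) t := by
  have hn0 : (n : ℝ) ≠ 0 := by
    have : n ≠ 0 := by omega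
    exact_mod_cast this
  have hpd : ∀ t, HasDerivAt p (τ / 2 + t / 8 * (τ ^ 2 + α⁻¹ * τ₀)) t := by
    intro t
    have h : p = fun t => 1 + (τ / 2) * t + (t ^ 2 / 16) * (τ ^ 2 + α⁻¹ * τ₀) := funext hp
    rw [h]
    have h1 := (((hasDerivAt_id t).const_mul (τ / 2)).const_add 1).add
      ((((hasDerivAt_id t).pow 2).div_const 16).mul_const (τ ^ 2 + α⁻¹ * τ₀))
    refine HasDerivAt.congr_deriv h1 ?_
    simp only [id, Nat.cast_ofNat]
    ring
  have hqd : ∀ t, HasDerivAt (fun t : ℝ => τ / 2 + t / 8 * (τ ^ 2 + α⁻¹ * τ₀))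
      (1 / 8 * (τ ^ 2 + α⁻¹ * τ₀)) t := by
    intro t
    exact (((hasDerivAt_id t).div_const 8).mul_const _).const_add _
  have hp0 : p 0 = 1 := by rw [hp]; ring
  have hpc : Continuous p := continuous_iff_continuousAt.2 fun t => (hpd t).continuousAt
  refine ⟨by rw [ha, hp0]; simp, by rw [hb]; simp,
    fun t => (2 / (n : ℝ)) * ((τ / 2 + t / 8 * (τ ^ 2 + α⁻¹ * τ₀)) / p t),
    fun t => (p t)⁻¹, ?_, ?_, ?_⟩
  · simp only [hp0]
    field_simp
    ring
  · simp [hp0]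
  intro t ht
  have hpt : p t ≠ 0 := (hpos t ht).ne'
  refine ⟨?_, ?_, ?_, ?_⟩
  · rw [show a = _ from funext ha]
    exact ((hpd t).log hpt).const_mul _
  · rw [show b = _ from funext hb]
    refine intervalIntegral.integral_hasDerivAt_right ?_ ?_ (hpc.continuousAt.inv₀ hpt)
    · apply ContinuousOn.intervalIntegrable
      intro s hs
      rw [Set.uIcc_of_le ht.1] at hs
      exact (hpc.continuousAt.inv₀ (hpos s ⟨hs.1, hs.2.trans_lt ht.2⟩).ne').continuousWithinAt
    · exact (hpc.measurable.inv.stronglyMeasurable).stronglyMeasurableAtFilter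
  · have h1 := ((hqd t).div (hpd t) hpt).const_mul (2 / (n : ℝ))
    refine HasDerivAt.congr_deriv h1 ?_
    have key : 2 * p t * (1 / 8 * (τ ^ 2 + α⁻¹ * τ₀)) -
        (τ / 2 + t / 8 * (τ ^ 2 + α⁻¹ * τ₀)) ^ 2 = τ₀ * α⁻¹ / 4 := by
      rw [hp]; ring
    have e : τ₀ / (4 * α * (n : ℝ)) = (τ₀ * α⁻¹ / 4) / n := by field_simp
    rw [e, ← key]
    generalize τ ^ 2 + α⁻¹ * τ₀ = c
    field_simp
    ring
  · have h1 := (hpd t).inv hpt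
    refine HasDerivAt.congr_deriv h1 ?_
    field_simp
end

section
/- Let E be a real vector space and P : E → E a linear map with P ∘ P = id, and set V = ker(P − id). Then for every linear map ξ : E → E, the following are equivalent: (i) V ⊆ ker ξ and ξ ∘ P + P ∘ ξ = 0; (ii) range ξ ⊆ V and V ⊆ ker ξ. -/
theorem stmt15 (E : Type*) [AddCommGroup E] [Module ℝ E]
    (P : E →ₗ[ℝ] E) (hP : P ∘ₗ P = LinearMap.id)
    (V : Submodule ℝ E) (hV : V = LinearMap.ker (P - LinearMap.id))
    (ξ : E →ₗ[ℝ] E) :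
    (V ≤ LinearMap.ker ξ ∧ ξ ∘ₗ P + P ∘ₗ ξ = 0) ↔
    (LinearMap.range ξ ≤ V ∧ V ≤ LinearMap.ker ξ) := by
  have hPP : ∀ x, P (P x) = x := fun x => LinearMap.congr_fun hP x
  have hmem : ∀ x, x ∈ V ↔ P x = x := by
    intro x
    rw [hV, LinearMap.mem_ker, LinearMap.sub_apply, LinearMap.id_apply, sub_eq_zero]
  have key : V ≤ LinearMap.ker ξ → ∀ x, ξ (P x) = -ξ x := by
    intro h x
    have h1 : P x + x ∈ V := by
      rw [hmem, map_add, hPP, add_comm]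
    have h2 := h h1
    rw [LinearMap.mem_ker, map_add] at h2
    exact eq_neg_of_add_eq_zero_left h2
  constructor
  · rintro ⟨h, h0⟩
    refine ⟨?_, h⟩
    rintro _ ⟨x, rfl⟩
    rw [hmem]
    have h1 : ξ (P x) + P (ξ x) = 0 := LinearMap.congr_fun h0 x
    rw [key h x] at h1
    exact (neg_add_eq_zero.mp h1).symm
  · rintro ⟨hr, h⟩
    refine ⟨h, ?_⟩
    ext x
    have h1 : P (ξ x) = ξ x := (hmem _).1 (hr ⟨x, rfl⟩)
    change ξ (P x) + P (ξ x) = 0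
    rw [key h x, h1, neg_add_cancel]
end

section
/- Let E be a finite-dimensional real vector space, V ⊆ E a subspace, and p : E → E/V the quotient map. Let P_V = {P : E → E linear : P ∘ P = id and ker(P − id) = V}; for P ∈ P_V let v^P = ½(P + id), which maps E into V. Then the map Ψ sending a triple (g₁, g₂, P), where g₁ is a positive definite symmetric bilinear form on E/V, g₂ is a positive definite symmetric bilinear form on V, and P ∈ P_V, to the bilinear form g(x,y) = g₁(p x, p y) + g₂(v^P x, v^P y) on E, is a bijection onto the set of positive definite symmetric bilinear forms on E. -/
/-- A triple `(g₁, g₂, P)`: a positive definite symmetric bilinear form on `E/V`,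
a positive definite symmetric bilinear form on `V`, and an almost product structure
`P` with vertical space `V` (`P² = id`, `ker(P − id) = V`). -/
structure MetricTriple (E : Type*) [AddCommGroup E] [Module ℝ E]
    (V : Submodule ℝ E) where
  g₁ : (E ⧸ V) →ₗ[ℝ] (E ⧸ V) →ₗ[ℝ] ℝ
  g₁_symm : ∀ x y, g₁ x y = g₁ y x
  g₁_pos : ∀ x, x ≠ 0 → 0 < g₁ x x
  g₂ : V →ₗ[ℝ] V →ₗ[ℝ] ℝ
  g₂_symm : ∀ x y, g₂ x y = g₂ y x
  g₂_pos : ∀ x, x ≠ 0 → 0 < g₂ x x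
  P : E →ₗ[ℝ] E
  hP : P ∘ₗ P = LinearMap.id
  hker : LinearMap.ker (P - LinearMap.id) = V

/-- The vertical projection `v^P = ½(P + id)`, viewed as a map into `V`. -/
noncomputable def vProj {E : Type*} [AddCommGroup E] [Module ℝ E]
    {V : Submodule ℝ E} (t : MetricTriple E V) : E →ₗ[ℝ] V :=
  LinearMap.codRestrict V (((1 : ℝ) / 2) • (t.P + LinearMap.id)) (fun x => by
    have hPP : t.P (t.P x) = x := by
      have := LinearMap.ext_iff.mp t.hP x
      simpa using this
    have hmem : ((((1 : ℝ) / 2) • (t.P + LinearMap.id) : E →ₗ[ℝ] E)) x ∈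
        LinearMap.ker (t.P - LinearMap.id) := by
      rw [LinearMap.mem_ker]
      simp only [LinearMap.sub_apply, LinearMap.smul_apply, LinearMap.add_apply,
        LinearMap.id_apply, map_smul, map_add, hPP]
      module
    rwa [t.hker] at hmem)

/-- The map `Ψ` of Proposition 4.4, pointwise:
`Ψ(g₁,g₂,P)(x,y) = g₁(p x, p y) + g₂(v^P x, v^P y)`. -/
noncomputable def PsiMap {E : Type*} [AddCommGroup E] [Module ℝ E]
    (V : Submodule ℝ E) (t : MetricTriple E V) : E →ₗ[ℝ] E →ₗ[ℝ] ℝ :=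
  t.g₁.compl₁₂ V.mkQ V.mkQ + t.g₂.compl₁₂ (vProj t) (vProj t)

theorem vProj_coe {E : Type*} [AddCommGroup E] [Module ℝ E]
    {V : Submodule ℝ E} (t : MetricTriple E V) (x : E) :
    (vProj t x : E) = ((1 : ℝ) / 2) • (t.P x + x) := rfl

theorem P_eq_self {E : Type*} [AddCommGroup E] [Module ℝ E]
    {V : Submodule ℝ E} (t : MetricTriple E V) (v : V) : t.P v = v := by
  have h : (v : E) ∈ LinearMap.ker (t.P - LinearMap.id) := by
    rw [t.hker]; exact v.2
  rw [LinearMap.mem_ker] at h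
  exact sub_eq_zero.mp h

theorem vProj_self {E : Type*} [AddCommGroup E] [Module ℝ E]
    {V : Submodule ℝ E} (t : MetricTriple E V) (v : V) : vProj t v = v := by
  apply Subtype.ext
  rw [vProj_coe, P_eq_self]
  module

theorem PsiMap_app {E : Type*} [AddCommGroup E] [Module ℝ E]
    (V : Submodule ℝ E) (t : MetricTriple E V) (x y : E) :
    PsiMap V t x y = t.g₁ (V.mkQ x) (V.mkQ y) + t.g₂ (vProj t x) (vProj t y) := rfl

theorem PsiMap_right {E : Type*} [AddCommGroup E] [Module ℝ E]
    (V : Submodule ℝ E) (t : MetricTriple E V) (x : E) (v : V) :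
    PsiMap V t x v = t.g₂ (vProj t x) v := by
  have h : V.mkQ (v : E) = 0 := by simp
  rw [PsiMap_app, vProj_self, h, map_zero, zero_add]

theorem PsiMap_inj {E : Type*} [AddCommGroup E] [Module ℝ E]
    (V : Submodule ℝ E) : Function.Injective (PsiMap V) := by
  intro s t hst
  have h2 : s.g₂ = t.g₂ := by
    ext u v
    have := PsiMap_right V s u v
    rw [hst, PsiMap_right, vProj_self, vProj_self] at this
    exact this.symm
  have hv : ∀ x, vProj s x = vProj t x := by
    intro x
    by_contra hne
    have hp := s.g₂_pos _ (sub_ne_zero.mpr hne)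
    have h := PsiMap_right V s x (vProj s x - vProj t x)
    rw [hst, PsiMap_right, ← h2] at h
    rw [map_sub s.g₂, LinearMap.sub_apply, ← h, sub_self] at hp
    exact lt_irrefl _ hp
  have hP : s.P = t.P := by
    ext x
    have h := congrArg (Subtype.val) (hv x)
    rw [vProj_coe, vProj_coe] at h
    have h' := smul_right_injective E (by norm_num : (1 / 2 : ℝ) ≠ 0) h
    exact add_right_cancel h'
  have h1 : s.g₁ = t.g₁ := by
    ext x y
    have h : PsiMap V s x y = PsiMap V t x y := by rw [hst]
    rw [PsiMap_app, PsiMap_app, hv, hv, h2] at h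
    exact add_right_cancel h
  cases s; cases t
  simp only at h1 h2 hP
  subst h1 h2 hP
  rfl

theorem PsiMap_symm_pos {E : Type*} [AddCommGroup E] [Module ℝ E]
    (V : Submodule ℝ E) (t : MetricTriple E V) :
    (∀ x y, PsiMap V t x y = PsiMap V t y x) ∧ ∀ x, x ≠ 0 → 0 < PsiMap V t x x := by
  refine ⟨fun x y => ?_, fun x hx => ?_⟩
  · rw [PsiMap_app, PsiMap_app, t.g₁_symm, t.g₂_symm]
  · by_cases hV : x ∈ V
    · have h := PsiMap_right V t x ⟨x, hV⟩
      have h' := vProj_self t ⟨x, hV⟩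
      simp only at h h'
      rw [h, h']
      exact t.g₂_pos _ (fun h0 => hx (congrArg Subtype.val h0))
    · rw [PsiMap_app]
      have h1 : 0 < t.g₁ (V.mkQ x) (V.mkQ x) := by
        apply t.g₁_pos
        intro h
        exact hV ((Submodule.Quotient.mk_eq_zero V).mp h)
      have h2 : 0 ≤ t.g₂ (vProj t x) (vProj t x) := by
        by_cases h0 : vProj t x = 0
        · rw [h0]; simp
        · exact (t.g₂_pos _ h0).le
      linarith

theorem exists_orth {E : Type*} [AddCommGroup E] [Module ℝ E] [FiniteDimensional ℝ E]
    (V : Submodule ℝ E) (g : E →ₗ[ℝ] E →ₗ[ℝ] ℝ) (hp : ∀ x, x ≠ 0 → 0 < g x x) :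
    ∃ q : E →ₗ[ℝ] V, (∀ x, ∀ v : V, g (q x) v = g x v) ∧ ∀ v : V, q v = v := by
  let B : E →ₗ[ℝ] Module.Dual ℝ V := g.compl₂ V.subtype
  let b : V →ₗ[ℝ] Module.Dual ℝ V := B ∘ₗ V.subtype
  have hb : Function.Injective b := by
    rw [← LinearMap.ker_eq_bot, LinearMap.ker_eq_bot']
    intro v hv
    by_contra hne
    have h := hp v (fun h0 => hne (Subtype.ext h0))
    have h' : g v v = 0 := LinearMap.congr_fun hv v
    linarith
  let e : V ≃ₗ[ℝ] Module.Dual ℝ V :=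
    LinearEquiv.ofInjectiveOfFinrankEq b hb (Subspace.dual_finrank_eq).symm
  have he : ∀ v, e v = b v := fun v => rfl
  refine ⟨e.symm.toLinearMap ∘ₗ B, fun x v => ?_, fun v => ?_⟩
  · have h : b (e.symm (B x)) = B x := by rw [← he, e.apply_symm_apply]
    exact LinearMap.congr_fun h v
  · exact e.symm_apply_apply v

theorem PsiMap_surj {E : Type*} [AddCommGroup E] [Module ℝ E] [FiniteDimensional ℝ E]
    (V : Submodule ℝ E) (g : E →ₗ[ℝ] E →ₗ[ℝ] ℝ) (hs : ∀ x y, g x y = g y x)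
    (hp : ∀ x, x ≠ 0 → 0 < g x x) : ∃ t, PsiMap V t = g := by
  obtain ⟨q, hq, hqv⟩ := exists_orth V g hp
  let h : E →ₗ[ℝ] E := LinearMap.id - V.subtype ∘ₗ q
  have hh : ∀ x, h x = x - q x := fun x => rfl
  have hV : V ≤ LinearMap.ker h := by
    intro v hv
    have := hqv ⟨v, hv⟩
    simp only at this
    rw [LinearMap.mem_ker, hh, this, sub_self]
  let l : (E ⧸ V) →ₗ[ℝ] E := V.liftQ h hV
  have hl : ∀ x, l (V.mkQ x) = x - q x := fun x => rfl
  let t : MetricTriple E V :=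
    { g₁ := g.compl₁₂ l l
      g₁_symm := fun x y => hs _ _
      g₁_pos := by
        intro x hx
        obtain ⟨x, rfl⟩ := V.mkQ_surjective x
        apply hp
        intro h0
        apply hx
        rw [hl, sub_eq_zero] at h0
        rw [h0]
        simp
      g₂ := g.compl₁₂ V.subtype V.subtype
      g₂_symm := fun x y => hs _ _
      g₂_pos := fun x hx => hp _ (fun h0 => hx (Subtype.ext h0))
      P := (2 : ℝ) • (V.subtype ∘ₗ q) - LinearMap.id
      hP := by
        ext x
        simp [hqv]
        module
      hker := by
        ext x
        rw [LinearMap.mem_ker]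
        constructor
        · intro h0
          have h1 : (2 : ℝ) • ((q x : E) - x) = 0 := by
            rw [← h0]
            simp
            module
          have h2 := (smul_eq_zero.mp h1).resolve_left (by norm_num)
          rw [← sub_eq_zero.mp h2]
          exact (q x).2
        · intro hx
          have := hqv ⟨x, hx⟩
          simp only at this
          simp [this]
          module }
  refine ⟨t, ?_⟩
  have hvt : ∀ x, (vProj t x : E) = q x := by
    intro x
    rw [vProj_coe]
    change ((1 : ℝ) / 2) • (((2 : ℝ) • (q x : E) - x) + x) = _
    module
  ext x y
  rw [PsiMap_app]
  change g (x - q x) (y - q y) + g (vProj t x) (vProj t y) = g x y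
  rw [hvt, hvt]
  have e1 := hq x (q y)
  have e2 := hq y (q x)
  rw [hs y, hs (q y)] at e2
  simp only [map_sub, LinearMap.sub_apply]
  linarith

theorem stmt16 (E : Type*) [AddCommGroup E] [Module ℝ E] [FiniteDimensional ℝ E]
    (V : Submodule ℝ E) :
    Function.Injective (PsiMap V) ∧
    Set.range (PsiMap V) =
      {g : E →ₗ[ℝ] E →ₗ[ℝ] ℝ | (∀ x y, g x y = g y x) ∧ ∀ x, x ≠ 0 → 0 < g x x} := by
  refine ⟨PsiMap_inj V, ?_⟩
  ext g
  constructor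
  · rintro ⟨t, rfl⟩
    exact PsiMap_symm_pos V t
  · rintro ⟨hs, hp⟩
    exact PsiMap_surj V g hs hp
end

section
/- Let g be a symmetric positive definite n×n real matrix, and let P be an n×n real matrix with P² = 1 and (gP)ᵀ = gP. Set v = ½(P + 1) and w = ½(1 − P). Let k be a symmetric n×n real matrix and H = g⁻¹k, and assume vHv = 0 and wHw = 0. Then for every real t, wᵀ·g·w + (v + t·vHw)ᵀ·g·(v + t·vHw) = g + t·k + t²·g·H²·w. -/
open Matrix

theorem stmt19 (n : ℕ) (g : Matrix (Fin n) (Fin n) ℝ) (hg : g.PosDef)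
    (P : Matrix (Fin n) (Fin n) ℝ) (hP : P * P = 1) (hgP : (g * P)ᵀ = g * P)
    (v w : Matrix (Fin n) (Fin n) ℝ)
    (hv : v = ((1 : ℝ) / 2) • (P + 1)) (hw : w = ((1 : ℝ) / 2) • (1 - P))
    (k : Matrix (Fin n) (Fin n) ℝ) (hk : kᵀ = k)
    (H : Matrix (Fin n) (Fin n) ℝ) (hH : H = g⁻¹ * k)
    (h1 : v * H * v = 0) (h2 : w * H * w = 0) (t : ℝ) :
    wᵀ * g * w + (v + t • (v * H * w))ᵀ * g * (v + t • (v * H * w))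
      = g + t • k + t ^ 2 • (g * (H * H) * w) := by
  have hgT : gᵀ = g := by
    have := hg.isHermitian
    rwa [Matrix.IsHermitian, Matrix.conjTranspose_eq_transpose_of_trivial] at this
  have hu : IsUnit g.det := (Matrix.isUnit_iff_isUnit_det g).mp hg.isUnit
  have hgH : g * H = k := by rw [hH, Matrix.mul_nonsing_inv_cancel_left _ _ hu]
  have hPg : Pᵀ * g = g * P := by rw [← hgP, Matrix.transpose_mul, hgT]
  have hHg : Hᵀ * g = g * H := by
    have h := congrArg Matrix.transpose hgH
    rw [Matrix.transpose_mul, hgT, hk] at h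
    rw [h, hgH]
  have hvg : vᵀ * g = g * v := by
    rw [hv]; simp [add_mul, mul_add, hPg]
  have hwg : wᵀ * g = g * w := by
    rw [hw]; simp [sub_mul, mul_sub, hPg]
  have hvw : v + w = 1 := by rw [hv, hw]; module
  have hvv : v * v = v := by
    rw [hv]; simp only [smul_mul_assoc, mul_smul_comm, add_mul, mul_add, hP, one_mul, mul_one]; module
  have hww : w * w = w := by
    rw [hw]; simp only [smul_mul_assoc, mul_smul_comm, sub_mul, mul_sub, hP, one_mul, mul_one]; module
  have hHw : v * H * w = H * w := by
    calc v * H * w = v * H * w + w * H * w := by rw [h2, add_zero]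
      _ = (v + w) * H * w := by noncomm_ring
      _ = H * w := by rw [hvw, one_mul]
  have hHv : w * H * v = H * v := by
    calc w * H * v = v * H * v + w * H * v := by rw [h1, zero_add]
      _ = (v + w) * H * v := by noncomm_ring
      _ = H * v := by rw [hvw, one_mul]
  have hvHw : v * (H * w) = H * w := by rw [← mul_assoc, hHw]
  have hHT : (H * w)ᵀ * g = g * (H * v) := by
    rw [← hHw, ← hHv]
    simp only [Matrix.transpose_mul, mul_assoc, hvg]
    rw [← mul_assoc Hᵀ g v, hHg, mul_assoc, ← mul_assoc wᵀ g, hwg, mul_assoc]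
  have hHvv : H * v * v = H * v := by rw [mul_assoc, hvv]
  have hHvHw : H * v * (H * w) = H * H * w := by rw [mul_assoc, hvHw, mul_assoc]
  rw [hHw, Matrix.transpose_add, Matrix.transpose_smul, add_mul, hwg, hvg, smul_mul_assoc, hHT]
  calc g * w * w + (g * v + t • (g * (H * v))) * (v + t • (H * w))
      = g * (w * w + v * v) + t • (g * (v * (H * w) + H * v * v))
        + t ^ 2 • (g * (H * v * (H * w))) := by
        simp only [add_mul, mul_add, smul_mul_assoc, mul_smul_comm, mul_assoc]
        module
    _ = _ := by
        rw [hww, hvv, hvHw, hHvv, hHvHw, ← mul_add, add_comm w v, hvw, mul_one, mul_one, hgH, mul_assoc g (H * H) w]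
end
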